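/- (Return probability of DCF from the one-part state) Let n ≥ 2, let sₙ = (n,0,0,…) ∈ 𝒫ₙ, and let X⁽ⁿ⁾ be the DCF⁽ⁿ⁾ chain started at X⁽ⁿ⁾(0) = sₙ. Then for every k ≥ 1, P⁽ⁿ⁾(X⁽ⁿ⁾(2k) = sₙ) = (1/n)·Σ_{i=1}^{n} ((2i − n − 1)/(n − 1))^{2k}, and there exists a constant C > 0 independent of n and k such that P⁽ⁿ⁾(X⁽ⁿ⁾(2k) = sₙ) ≥ C/k for all 1 ≤ k < n. -/

import Mathlib

open MeasureTheory ENNReal Filter Set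

noncomputable section

/-- The set `𝒫ₙ` of integer partitions of `n`, as nonincreasing sequences. -/
def PartN (n : ℕ) : Set (ℕ → ℕ) :=
  {l | Antitone l ∧ ∑' i, (l i : ℝ≥0∞) = n}

/-- `N_ℓ(k)`, the number of parts of `ℓ` equal to `k`. -/
def typeCount (l : ℕ → ℕ) (k : ℕ) : ℕ := Nat.card {i | l i = k}

/-- `N_ℓ`, the total number of nonzero parts of `ℓ`. -/
def numParts (l : ℕ → ℕ) : ℕ := Nat.card {i | l i ≠ 0}

/-- `ℓ'` is obtained from `ℓ` by merging a part of size `j` and a part of size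
`k` (`j ≠ k`), expressed through the type counts. -/
def MergeRel (j k : ℕ) (l l' : ℕ → ℕ) : Prop :=
  typeCount l j = typeCount l' j + 1 ∧ typeCount l k = typeCount l' k + 1 ∧
  typeCount l' (j + k) = typeCount l (j + k) + 1 ∧
  ∀ q, q ∉ ({j, k, j + k} : Set ℕ) → typeCount l' q = typeCount l q

/-- `ℓ'` is obtained from `ℓ` by merging two parts of equal size `j`. -/
def EqMergeRel (j : ℕ) (l l' : ℕ → ℕ) : Prop :=
  typeCount l j = typeCount l' j + 2 ∧ typeCount l' (2 * j) = typeCount l (2 * j) + 1 ∧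
  ∀ q, q ∉ ({j, 2 * j} : Set ℕ) → typeCount l' q = typeCount l q

open Classical in
/-- The transition matrix `K⁽ⁿ⁾` of the discrete coagulation-fragmentation chain
DCF⁽ⁿ⁾ (the cycle-type evolution of random transpositions on `Sₙ`): merge and
split rates as in the paper, all other entries being `0`. -/
def Kmat (n : ℕ) (l l' : ℕ → ℕ) : ℝ :=
  (∑ j ∈ Finset.range (n + 1), ∑ k ∈ Finset.range (n + 1),
    ((if 1 ≤ j ∧ j < k ∧ MergeRel j k l l' then
        2 * (j : ℝ) * (k : ℝ) * (typeCount l j : ℝ) * (typeCount l k : ℝ) /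
          ((n : ℝ) * ((n : ℝ) - 1)) else 0)
     + (if 1 ≤ j ∧ j < k ∧ MergeRel j k l' l then
        2 * ((j : ℝ) + (k : ℝ)) * (typeCount l (j + k) : ℝ) /
          ((n : ℝ) * ((n : ℝ) - 1)) else 0)))
  + ∑ j ∈ Finset.range (n + 1),
    ((if 1 ≤ j ∧ 2 * j ≤ n ∧ EqMergeRel j l l' then
        (j : ℝ) ^ 2 * (typeCount l j : ℝ) * ((typeCount l j : ℝ) - 1) /
          ((n : ℝ) * ((n : ℝ) - 1)) else 0)
     + (if 1 ≤ j ∧ 2 * j ≤ n ∧ EqMergeRel j l' l then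
        2 * (j : ℝ) * (typeCount l (2 * j) : ℝ) / ((n : ℝ) * ((n : ℝ) - 1)) else 0))

/-- The Ewens measure `π_S⁽ⁿ⁾(ℓ) = (∏_{k=1}^n k^{N_ℓ(k)} N_ℓ(k)!)⁻¹
  = (∏ᵢ ℓᵢ ∏_{k=1}^n N_ℓ(k)!)⁻¹` on `𝒫ₙ`. -/
def ewens (n : ℕ) (l : ℕ → ℕ) : ℝ :=
  (∏ k ∈ Finset.Icc 1 n,
    ((k : ℝ) ^ typeCount l k * (Nat.factorial (typeCount l k) : ℝ)))⁻¹

open Classical in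
/-- Matrix powers of the DCF⁽ⁿ⁾ transition matrix (entries of `K⁽ⁿ⁾ᵏ`). -/
def Kpow (n : ℕ) : ℕ → (ℕ → ℕ) → (ℕ → ℕ) → ℝ
  | 0 => fun l m => if l = m then 1 else 0
  | (k + 1) => fun l m => ∑' x : PartN n, Kpow n k l x * Kmat n x m

/-- The one-part partition `sₙ = (n, 0, 0, …) ∈ 𝒫ₙ`. -/
def oneBlock (n : ℕ) : ℕ → ℕ := fun i => if i = 0 then n else 0

/-! ### Real-variable identities -/

lemma sum_sum_range_of_symm (f : ℕ → ℕ → ℝ) (hf : ∀ j k, f j k = f k j) (m : ℕ) :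
    ∑ j ∈ Finset.range m, ∑ k ∈ Finset.range m, f j k =
      ∑ j ∈ Finset.range m, ∑ k ∈ Finset.range m, (if j < k then 2 * f j k else 0) +
        ∑ j ∈ Finset.range m, f j j := by
  have h1 : ∑ j ∈ Finset.range m, ∑ k ∈ Finset.range m, f j k =
      ∑ j ∈ Finset.range m, ∑ k ∈ Finset.range m, (if j < k then f j k else 0) +
      ∑ j ∈ Finset.range m, ∑ k ∈ Finset.range m, (if k < j then f j k else 0) +
      ∑ j ∈ Finset.range m, ∑ k ∈ Finset.range m, (if j = k then f j k else 0) := by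
    simp only [← Finset.sum_add_distrib]
    refine Finset.sum_congr rfl fun j _ => Finset.sum_congr rfl fun k _ => ?_
    rcases lt_trichotomy j k with h | h | h
    · simp [h, h.ne, h.not_gt]
    · simp [h]
    · simp [h, h.ne', h.not_gt]
  have h2 : ∑ j ∈ Finset.range m, ∑ k ∈ Finset.range m, (if k < j then f j k else 0) =
      ∑ j ∈ Finset.range m, ∑ k ∈ Finset.range m, (if j < k then f j k else 0) := by
    rw [Finset.sum_comm]
    exact Finset.sum_congr rfl fun j _ => Finset.sum_congr rfl fun k _ => by rw [hf]
  have h3 : ∑ j ∈ Finset.range m, ∑ k ∈ Finset.range m, (if j = k then f j k else 0) =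
      ∑ j ∈ Finset.range m, f j j := by
    refine Finset.sum_congr rfl fun j hj => ?_
    simp only [Finset.sum_ite_eq, hj, if_true]
  rw [h1, h2, h3]
  congr 1
  simp only [← Finset.sum_add_distrib]
  refine Finset.sum_congr rfl fun j _ => Finset.sum_congr rfl fun k _ => ?_
  split_ifs <;> ring

lemma sum_sum_range_eq_sum_diag (h : ℕ → ℕ → ℝ) (n : ℕ) (hh : ∀ j k, n < j + k → h j k = 0) :
    ∑ j ∈ Finset.range (n + 1), ∑ k ∈ Finset.range (n + 1), h j k =
      ∑ m ∈ Finset.range (n + 1), ∑ s ∈ Finset.range (m + 1), h s (m - s) := by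
  rw [Finset.sum_range_diag_flip]
  refine Finset.sum_congr rfl fun j _ => ?_
  symm
  refine Finset.sum_subset (Finset.range_subset_range.2 (by omega)) fun k _ hk => hh _ _ ?_
  simp only [Finset.mem_range] at hk
  omega

lemma one_sub_pow_ne_zero {x : ℝ} (hx : x ∈ Ioo (0 : ℝ) 1) {m : ℕ} (hm : m ≠ 0) :
    1 - x ^ m ≠ 0 :=
  (sub_pos.2 (pow_lt_one₀ hx.1.le hx.2 hm)).ne'

lemma sum_split_factor {x : ℝ} (hx : x ∈ Ioo (0 : ℝ) 1) {m : ℕ} (hm : m ≠ 0) :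
    ∑ s ∈ Finset.range (m + 1), (1 - x ^ s) * (1 - x ^ (m - s)) / (1 - x ^ m) =
      2 * m / (1 - x ^ m) - (m - 1) - 2 / (1 - x) := by
  have h0 := one_sub_pow_ne_zero hx hm
  have h1 : x - 1 ≠ 0 := (sub_neg.2 hx.2).ne
  have h1' : 1 - x ≠ 0 := (sub_pos.2 hx.2).ne'
  have e1 : ∀ s ∈ Finset.range (m + 1), (1 - x ^ s) * (1 - x ^ (m - s)) / (1 - x ^ m) =
      ((1 + x ^ m) - x ^ s - x ^ (m - s)) / (1 - x ^ m) := by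
    intro s hs
    have : x ^ m = x ^ s * x ^ (m - s) := by
      rw [← pow_add]; congr 1; simp only [Finset.mem_range] at hs; omega
    congr 1
    linear_combination (-1) * this
  have e2 : ∑ s ∈ Finset.range (m + 1), x ^ (m - s) = ∑ s ∈ Finset.range (m + 1), x ^ s := by
    simpa using Finset.sum_range_reflect (fun s => x ^ s) (m + 1)
  rw [Finset.sum_congr rfl e1, ← Finset.sum_div, Finset.sum_sub_distrib, Finset.sum_sub_distrib,
    e2, geom_sum_eq (sub_ne_zero.1 h1)]
  simp only [Finset.sum_const, Finset.card_range, nsmul_eq_mul]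
  push_cast
  have h2 : (x ^ (m + 1) - 1) / (x - 1) = (1 - x * x ^ m) / (1 - x) := by
    rw [div_eq_div_iff h1 h1']; ring
  rw [h2]
  field_simp
  ring

/-- The action of the total jump rate on `∏ (1 - x ^ ℓᵢ)`, in terms of the multiplicities `N`. -/
lemma sum_merge_split {n : ℕ} (N : ℕ → ℕ) (hN : ∑ m ∈ Finset.range (n + 1), m * N m = n)
    (hN' : ∀ m, n < m → N m = 0) {x : ℝ} (hx : x ∈ Ioo (0 : ℝ) 1) :
    (∑ j ∈ Finset.range (n + 1), ∑ k ∈ Finset.range (n + 1),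
      ((if 1 ≤ j ∧ j < k then 2 * (j : ℝ) * k * N j * N k *
          ((1 - x ^ (j + k)) / ((1 - x ^ j) * (1 - x ^ k))) else 0) +
       (if 1 ≤ j ∧ j < k then 2 * ((j : ℝ) + k) * N (j + k) *
          ((1 - x ^ j) * (1 - x ^ k) / (1 - x ^ (j + k))) else 0))) +
    ∑ j ∈ Finset.range (n + 1),
      ((if 1 ≤ j ∧ 2 * j ≤ n then (j : ℝ) ^ 2 * N j * ((N j : ℝ) - 1) *
          ((1 - x ^ (j + j)) / ((1 - x ^ j) * (1 - x ^ j))) else 0) +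
       (if 1 ≤ j ∧ 2 * j ≤ n then 2 * (j : ℝ) * N (j + j) *
          ((1 - x ^ j) * (1 - x ^ j) / (1 - x ^ (j + j))) else 0)) =
    2 * n * ∑ m ∈ Finset.range (n + 1), m * N m / (1 - x ^ m) - n ^ 2 + n - 2 * n / (1 - x) := by
  have hNR : ∑ m ∈ Finset.range (n + 1), (m : ℝ) * N m = n := by exact_mod_cast hN
  have hle : ∀ j, n < 2 * j → (N j : ℝ) * ((N j : ℝ) - 1) = 0 := by
    intro j hj
    rcases lt_or_ge n j with h | h
    · simp [hN' j h]
    · have h1 : j * N j ≤ n := by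
        conv_rhs => rw [← hN]
        exact Finset.single_le_sum (f := fun m => m * N m) (fun _ _ => Nat.zero_le _)
          (Finset.mem_range.2 (by omega))
      have : N j < 2 := by
        by_contra! h2
        nlinarith
      interval_cases N j <;> simp
  set f : ℕ → ℕ → ℝ := fun j k => (j : ℝ) * N j * (k * N k) *
    ((1 - x ^ (j + k)) / ((1 - x ^ j) * (1 - x ^ k))) with hf
  set g : ℕ → ℕ → ℝ := fun j k => ((j : ℝ) + k) * N (j + k) *
    ((1 - x ^ j) * (1 - x ^ k) / (1 - x ^ (j + k))) with hg
  have hf' : ∀ j k, f j k = f k j := by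
    intro j k
    simp only [hf, add_comm k j, mul_comm (1 - x ^ k)]
    ring
  have hg' : ∀ j k, g j k = g k j := by
    intro j k
    simp only [hg, add_comm k j, mul_comm (1 - x ^ k), add_comm (k : ℝ)]
  have hfv : ∀ j k, f j k = (j : ℝ) * N j / (1 - x ^ j) * (k * N k) +
      (j * N j) * ((k : ℝ) * N k / (1 - x ^ k)) - (j * N j) * (k * N k) := by
    intro j k
    rcases eq_or_ne j 0 with rfl | hj
    · simp [hf]
    rcases eq_or_ne k 0 with rfl | hk
    · simp [hf]
    have h1 := one_sub_pow_ne_zero hx hj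
    have h2 := one_sub_pow_ne_zero hx hk
    simp only [hf, pow_add]
    field_simp
    ring
  have hF := sum_sum_range_of_symm f hf' (n + 1)
  have hG := sum_sum_range_of_symm g hg' (n + 1)
  have hF2 : ∑ j ∈ Finset.range (n + 1), ∑ k ∈ Finset.range (n + 1), f j k =
      2 * n * ∑ m ∈ Finset.range (n + 1), m * N m / (1 - x ^ m) - n ^ 2 := by
    simp only [hfv, Finset.sum_add_distrib, Finset.sum_sub_distrib, ← Finset.mul_sum,
      ← Finset.sum_mul, hNR]
    ring
  have hG2 : ∑ j ∈ Finset.range (n + 1), ∑ k ∈ Finset.range (n + 1), g j k =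
      ∑ m ∈ Finset.range (n + 1),
        (2 * ((m : ℝ) ^ 2 * N m / (1 - x ^ m)) - (m : ℝ) ^ 2 * N m + m * N m
          - 2 / (1 - x) * (m * N m)) := by
    rw [sum_sum_range_eq_sum_diag]
    · refine Finset.sum_congr rfl fun m _ => ?_
      rcases eq_or_ne m 0 with rfl | hm
      · simp [hg]
      have : ∀ s ∈ Finset.range (m + 1), g s (m - s) =
          (m * N m) * ((1 - x ^ s) * (1 - x ^ (m - s)) / (1 - x ^ m)) := by
        intro s hs
        have hs : s ≤ m := by simp only [Finset.mem_range] at hs; omega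
        simp only [hg, Nat.add_sub_cancel' hs, Nat.cast_sub hs, add_sub_cancel]
      rw [Finset.sum_congr rfl this, ← Finset.mul_sum, sum_split_factor hx hm]
      ring
    · intro j k h
      simp [hg, hN' _ h]
  have e1 : ∀ j ∈ Finset.range (n + 1), ∀ k ∈ Finset.range (n + 1),
      ((if 1 ≤ j ∧ j < k then 2 * (j : ℝ) * k * N j * N k *
          ((1 - x ^ (j + k)) / ((1 - x ^ j) * (1 - x ^ k))) else 0) +
       (if 1 ≤ j ∧ j < k then 2 * ((j : ℝ) + k) * N (j + k) *
          ((1 - x ^ j) * (1 - x ^ k) / (1 - x ^ (j + k))) else 0)) =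
      (if j < k then 2 * f j k else 0) + (if j < k then 2 * g j k else 0) := by
    intro j _ k _
    rcases Nat.eq_zero_or_pos j with rfl | hj
    · simp [hf, hg]
    · have : 1 ≤ j := hj
      simp only [this, true_and, hf, hg]
      split_ifs <;> ring
  have e2 : ∀ j ∈ Finset.range (n + 1),
      ((if 1 ≤ j ∧ 2 * j ≤ n then (j : ℝ) ^ 2 * N j * ((N j : ℝ) - 1) *
          ((1 - x ^ (j + j)) / ((1 - x ^ j) * (1 - x ^ j))) else 0) +
       (if 1 ≤ j ∧ 2 * j ≤ n then 2 * (j : ℝ) * N (j + j) *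
          ((1 - x ^ j) * (1 - x ^ j) / (1 - x ^ (j + j))) else 0)) =
      f j j + g j j - (2 * ((j : ℝ) ^ 2 * N j / (1 - x ^ j)) - (j : ℝ) ^ 2 * N j) := by
    intro j _
    rcases Nat.eq_zero_or_pos j with rfl | hj
    · simp [hf, hg]
    have h1 := one_sub_pow_ne_zero hx hj.ne'
    have h3 : (j : ℝ) ^ 2 * N j * ((N j : ℝ) - 1) *
          ((1 - x ^ (j + j)) / ((1 - x ^ j) * (1 - x ^ j))) =
        f j j - (2 * ((j : ℝ) ^ 2 * N j / (1 - x ^ j)) - (j : ℝ) ^ 2 * N j) := by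
      simp only [hf, pow_add]
      field_simp
      ring
    have h4 : 2 * (j : ℝ) * N (j + j) * ((1 - x ^ j) * (1 - x ^ j) / (1 - x ^ (j + j))) =
        g j j := by
      simp only [hg]; ring
    split_ifs with h
    · rw [h3, h4]; ring
    · have h5 : n < 2 * j := by
        by_contra! h6
        exact h ⟨hj, h6⟩
      have h6 : g j j = 0 := by simp [hg, hN' (j + j) (by omega)]
      rw [h6, add_zero, add_zero, ← h3, mul_assoc ((j : ℝ) ^ 2), hle j h5, mul_zero, zero_mul]
  rw [Finset.sum_congr rfl fun j hj => Finset.sum_congr rfl (e1 j hj), Finset.sum_congr rfl e2]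
  simp only [Finset.sum_add_distrib, Finset.sum_sub_distrib] at hF hG hG2 ⊢
  simp only [← Finset.mul_sum, hNR] at hF hG hG2 ⊢
  rw [hF2] at hF
  rw [hG2] at hG
  linear_combination (-1) * hF - hG

/-! ### Partitions as antitone sequences and as multisets -/

lemma PartN.eq_zero_of_le {n : ℕ} {l : ℕ → ℕ} (h : l ∈ PartN n) {i : ℕ} (hi : n ≤ i) :
    l i = 0 := by
  by_contra hne
  have h1 : ∀ j ∈ Finset.range (n + 1), (1 : ℝ≥0∞) ≤ (l j : ℝ≥0∞) := by
    intro j hj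
    have : l i ≤ l j := h.1 (by simp only [Finset.mem_range] at hj; omega)
    exact_mod_cast (by omega : 1 ≤ l j)
  have h2 := (Finset.sum_le_sum h1).trans
    ((ENNReal.sum_le_tsum (f := fun i => (l i : ℝ≥0∞)) _).trans_eq h.2)
  simp only [Finset.sum_const, Finset.card_range, nsmul_eq_mul, mul_one] at h2
  have : n + 1 ≤ n := by exact_mod_cast h2
  omega

lemma tsum_natCast_eq_sum {n : ℕ} {l : ℕ → ℕ} (h : ∀ i, n ≤ i → l i = 0) :
    ∑' i, (l i : ℝ≥0∞) = ((∑ i ∈ Finset.range n, l i : ℕ) : ℝ≥0∞) := by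
  rw [tsum_eq_sum (s := Finset.range n)]
  · push_cast; rfl
  · intro i hi
    simp [h i (by simpa using hi)]

lemma PartN.sum_map_range {n : ℕ} {l : ℕ → ℕ} (h : l ∈ PartN n) :
    ((Multiset.range n).map l).sum = n := by
  have := h.2
  rw [tsum_natCast_eq_sum fun i hi => PartN.eq_zero_of_le h hi] at this
  exact_mod_cast this

/-- The multiset of nonzero parts of a partition given as an antitone sequence. -/
def PartN.toPartition {n : ℕ} (l : PartN n) : Nat.Partition n :=
  Nat.Partition.ofSums n ((Multiset.range n).map l) (PartN.sum_map_range l.2)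

lemma typeCount_eq_count {n : ℕ} (l : PartN n) (k : ℕ) :
    typeCount l k = (PartN.toPartition l).parts.count k := by
  rcases Nat.eq_zero_or_pos k with rfl | hk
  · have h1 : Infinite {i | (l : ℕ → ℕ) i = 0} :=
      ((Set.Ici_infinite n).mono fun i hi => PartN.eq_zero_of_le l.2 hi).to_subtype
    rw [typeCount, Nat.card_eq_zero_of_infinite]
    simp [PartN.toPartition]
  · have h1 : {i | (l : ℕ → ℕ) i = k} =
        (((Finset.range n).filter fun i => k = (l : ℕ → ℕ) i : Finset ℕ) : Set ℕ) := by
      ext i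
      simp only [Set.mem_ofPred_eq, Finset.coe_filter, Finset.mem_range]
      refine ⟨fun h => ⟨?_, h.symm⟩, fun h => h.2.symm⟩
      by_contra! hi
      have := PartN.eq_zero_of_le l.2 hi
      omega
    rw [typeCount, h1, Nat.card_coe_set_eq, Set.ncard_coe_finset]
    simp only [PartN.toPartition, Nat.Partition.ofSums_parts]
    rw [Multiset.count_filter_of_pos (p := (· ≠ 0)) hk.ne', Multiset.count_map]
    rfl

lemma sortedGE_map_range {l : ℕ → ℕ} (h : Antitone l) (n : ℕ) :
    ((List.range n).map l).SortedGE := by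
  refine List.Pairwise.sortedGE ?_
  rw [List.pairwise_map]
  exact List.pairwise_lt_range.imp fun hab => h hab.le

lemma PartN.toPartition_injective (n : ℕ) :
    Function.Injective (PartN.toPartition (n := n)) := by
  intro l l' h
  have h1 : ∀ m : PartN n, (Multiset.range n).map (m : ℕ → ℕ) =
      (PartN.toPartition m).parts +
        Multiset.replicate (n - Multiset.card (PartN.toPartition m).parts) 0 := by
    intro m
    have h2 := Multiset.filter_add_not (· ≠ 0) ((Multiset.range n).map (m : ℕ → ℕ))
    have h3 : ((Multiset.range n).map (m : ℕ → ℕ)).filter (fun a => ¬ a ≠ 0) =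
        Multiset.replicate (n - Multiset.card (PartN.toPartition m).parts) 0 := by
      rw [Multiset.eq_replicate]
      refine ⟨?_, fun b hb => by simpa using (Multiset.mem_filter.1 hb).2⟩
      have := congrArg Multiset.card h2
      simp only [Multiset.card_add, Multiset.card_map, Multiset.card_range] at this
      simp only [PartN.toPartition, Nat.Partition.ofSums_parts]
      omega
    rw [← h3]
    exact h2.symm
  have h2 : (List.range n).map (l : ℕ → ℕ) = (List.range n).map (l' : ℕ → ℕ) := by
    refine List.Perm.eq_of_sortedGE (sortedGE_map_range l.2.1 n) (sortedGE_map_range l'.2.1 n) ?_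
    rw [← Multiset.coe_eq_coe]
    exact (h1 l).trans (h ▸ (h1 l').symm)
  ext i
  rcases lt_or_ge i n with hi | hi
  · exact List.map_inj_left.1 h2 i (List.mem_range.2 hi)
  · rw [PartN.eq_zero_of_le l.2 hi, PartN.eq_zero_of_le l'.2 hi]

lemma PartN.toPartition_surjective (n : ℕ) :
    Function.Surjective (PartN.toPartition (n := n)) := by
  intro p
  set L := p.parts.sort (· ≥ ·) with hL
  have hLp : (L : Multiset ℕ) = p.parts := Multiset.sort_eq _ _
  have hlen : L.length ≤ n := by
    have : Multiset.card p.parts • 1 ≤ p.parts.sum :=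
      Multiset.card_nsmul_le_sum fun x hx => p.parts_pos hx
    rw [p.parts_sum, ← hLp] at this
    simpa using this
  have hanti : Antitone fun i => L.getD i 0 := by
    intro i j hij
    rcases lt_or_ge j L.length with hj | hj
    · rcases hij.eq_or_lt with rfl | hij
      · rfl
      · have := List.pairwise_iff_getElem.1 (Multiset.pairwise_sort p.parts (· ≥ ·)) i j
          (hij.trans hj) hj hij
        simpa only [List.getD_eq_getElem _ _ hj, List.getD_eq_getElem _ _ (hij.trans hj)] using this
    · exact (List.getD_eq_default _ _ hj).trans_le (Nat.zero_le _)
  have hmap : (List.range n).map (fun i => L.getD i 0) =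
      L ++ List.replicate (n - L.length) 0 := by
    refine List.ext_getElem (by simp; omega) fun i h1 h2 => ?_
    simp only [List.getElem_map, List.getElem_range, List.getElem_append, List.getElem_replicate]
    split_ifs with h
    · exact List.getD_eq_getElem _ _ h
    · exact List.getD_eq_default _ _ (by omega)
  have hmap' : (Multiset.range n).map (fun i => L.getD i 0) =
      p.parts + Multiset.replicate (n - L.length) 0 := by
    rw [← hLp, ← Multiset.coe_replicate, Multiset.coe_add, ← hmap]
    rfl
  have hmem : (fun i => L.getD i 0) ∈ PartN n := by
    refine ⟨hanti, ?_⟩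
    rw [tsum_natCast_eq_sum (n := n) fun i hi => List.getD_eq_default _ _ (hlen.trans hi)]
    congr 1
    change ((Multiset.range n).map (fun i => L.getD i 0)).sum = n
    rw [hmap']
    simp [p.parts_sum]
  refine ⟨⟨_, hmem⟩, Nat.Partition.ext ?_⟩
  simp only [PartN.toPartition, Nat.Partition.ofSums_parts, hmap', Multiset.filter_add]
  rw [Multiset.filter_eq_self.2 fun a ha => (p.parts_pos ha).ne', Multiset.filter_eq_nil.2,
    add_zero]
  intro a ha
  simpa using Multiset.eq_of_mem_replicate ha

/-- Antitone sequences summing to `n` are the same as partitions of `n`. -/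
def PartN.equiv (n : ℕ) : PartN n ≃ Nat.Partition n :=
  Equiv.ofBijective PartN.toPartition
    ⟨PartN.toPartition_injective n, PartN.toPartition_surjective n⟩

instance (n : ℕ) : Fintype (PartN n) := Fintype.ofEquiv _ (PartN.equiv n).symm

lemma oneBlock_mem (n : ℕ) : oneBlock n ∈ PartN n := by
  refine ⟨fun i j hij => ?_, ?_⟩
  · simp only [oneBlock]
    split_ifs <;> omega
  · rw [tsum_eq_single 0]
    · simp [oneBlock]
    · intro i hi
      simp [oneBlock, hi]

lemma toPartition_oneBlock {n : ℕ} (hn : n ≠ 0) :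
    (PartN.toPartition ⟨oneBlock n, oneBlock_mem n⟩).parts = {n} := by
  have h : n ∈ (PartN.toPartition ⟨oneBlock n, oneBlock_mem n⟩).parts := by
    simp only [PartN.toPartition, Nat.Partition.ofSums_parts, Multiset.mem_filter,
      Multiset.mem_map, Multiset.mem_range]
    exact ⟨⟨0, Nat.pos_of_ne_zero hn, by simp [oneBlock]⟩, hn⟩
  set p := PartN.toPartition ⟨oneBlock n, oneBlock_mem n⟩
  obtain ⟨t, ht⟩ := Multiset.exists_cons_of_mem h
  have hs := p.parts_sum
  rw [ht, Multiset.sum_cons] at hs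
  have ht0 : t = 0 := Multiset.eq_zero_of_forall_notMem fun a ha => by
    have h1 := Multiset.le_sum_of_mem ha
    have h2 := p.parts_pos (ht ▸ Multiset.mem_cons_of_mem ha)
    omega
  rw [ht, ht0]
  rfl

lemma mergeRel_iff {n : ℕ} (l l' : PartN n) {j k : ℕ} (hj : 1 ≤ j) (hjk : j < k) :
    MergeRel j k l l' ↔
      (PartN.toPartition l').parts + {j, k} = (PartN.toPartition l).parts + {j + k} := by
  simp only [MergeRel, typeCount_eq_count]
  rw [Multiset.ext]
  simp only [Multiset.count_add, Multiset.insert_eq_cons, Multiset.count_cons,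
    Multiset.count_singleton, Set.mem_insert_iff, Set.mem_singleton_iff, not_or]
  constructor
  · rintro ⟨h1, h2, h3, h4⟩ q
    rcases eq_or_ne q j with rfl | hqj
    · grind
    rcases eq_or_ne q k with rfl | hqk
    · grind
    rcases eq_or_ne q (j + k) with rfl | hqjk
    · grind
    · have := h4 q ⟨hqj, hqk, hqjk⟩
      simp [*]
  · intro h
    refine ⟨?_, ?_, ?_, fun q hq => ?_⟩
    · have := h j; grind
    · have := h k; grind
    · have := h (j + k); grind
    · have := h q; grind

lemma eqMergeRel_iff {n : ℕ} (l l' : PartN n) {j : ℕ} (hj : 1 ≤ j) :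
    EqMergeRel j l l' ↔
      (PartN.toPartition l').parts + {j, j} = (PartN.toPartition l).parts + {j + j} := by
  simp only [EqMergeRel, typeCount_eq_count, two_mul]
  rw [Multiset.ext]
  simp only [Multiset.count_add, Multiset.insert_eq_cons, Multiset.count_cons,
    Multiset.count_singleton, Set.mem_insert_iff, Set.mem_singleton_iff, not_or]
  constructor
  · rintro ⟨h1, h3, h4⟩ q
    rcases eq_or_ne q j with rfl | hqj
    · grind
    rcases eq_or_ne q (j + j) with rfl | hqjk
    · grind
    · have := h4 q ⟨hqj, hqjk⟩
      simp [*]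
  · intro h
    refine ⟨?_, ?_, fun q hq => ?_⟩
    · have := h j; grind
    · have := h (j + j); grind
    · have := h q; grind

/-! ### The generator acting on products `∏ (1 - x ^ ℓᵢ)` -/

/-- The product of `1 - x ^ a` over the elements `a` of a multiset. -/
def oneSubPowProd (x : ℝ) (s : Multiset ℕ) : ℝ := (s.map fun a => 1 - x ^ a).prod

lemma oneSubPowProd_add (x : ℝ) (s t : Multiset ℕ) :
    oneSubPowProd x (s + t) = oneSubPowProd x s * oneSubPowProd x t := by
  simp [oneSubPowProd]

lemma oneSubPowProd_ne_zero {x : ℝ} (hx : x ∈ Ioo (0 : ℝ) 1) {s : Multiset ℕ}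
    (hs : ∀ a ∈ s, a ≠ 0) : oneSubPowProd x s ≠ 0 := by
  refine Multiset.prod_ne_zero fun h => ?_
  obtain ⟨a, ha, h0⟩ := Multiset.mem_map.1 h
  exact one_sub_pow_ne_zero hx (hs a ha) h0

lemma sum_ite_exchange {n : ℕ} (p : Nat.Partition n) {A B : Multiset ℕ} (hAB : A.sum = B.sum)
    (hA : ∀ a ∈ A, a ≠ 0) (hB : ∀ b ∈ B, b ≠ 0) {x : ℝ} (hx : x ∈ Ioo (0 : ℝ) 1)
    {c : ℝ} (hc : c ≠ 0 → A ≤ p.parts) (P : PartN n → Prop) [DecidablePred P]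
    (hP : ∀ l, P l ↔ (PartN.toPartition l).parts + A = p.parts + B) :
    ∑ l, (if P l then c else 0) * oneSubPowProd x (PartN.toPartition l).parts =
      c * (oneSubPowProd x p.parts * (oneSubPowProd x B / oneSubPowProd x A)) := by
  rcases eq_or_ne c 0 with rfl | h0
  · simp
  have hle := hc h0
  have hsum : (p.parts - A + B).sum = n := by
    rw [Multiset.sum_add, ← hAB, ← Multiset.sum_add, Multiset.sub_add_cancel hle, p.parts_sum]
  let q : Nat.Partition n := ⟨p.parts - A + B, fun {i} hi => by
    rcases Multiset.mem_add.1 hi with h | h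
    · exact p.parts_pos (Multiset.mem_of_le (Multiset.sub_le_self _ _) h)
    · exact Nat.pos_of_ne_zero (hB i h), hsum⟩
  obtain ⟨l₀, hl₀⟩ := PartN.toPartition_surjective n q
  have hq : (PartN.toPartition l₀).parts + A = p.parts + B := by
    rw [hl₀]
    change p.parts - A + B + A = _
    rw [add_right_comm, Multiset.sub_add_cancel hle]
  rw [Finset.sum_eq_single l₀]
  · rw [if_pos ((hP l₀).2 hq)]
    congr 1
    have := congrArg (oneSubPowProd x) hq
    rw [oneSubPowProd_add, oneSubPowProd_add] at this
    rw [← mul_div_assoc, eq_div_iff (oneSubPowProd_ne_zero hx hA), this]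
  · intro l _ hl
    rw [if_neg, zero_mul]
    intro h
    refine hl (PartN.toPartition_injective n (Nat.Partition.ext ?_))
    exact add_right_cancel (((hP l).1 h).trans hq.symm)
  · simp

lemma pair_le_of_count {s : Multiset ℕ} {j k : ℕ} (hjk : j ≠ k) (hj : s.count j ≠ 0)
    (hk : s.count k ≠ 0) : ({j, k} : Multiset ℕ) ≤ s := by
  rw [Multiset.le_iff_count]
  intro q
  simp only [Multiset.insert_eq_cons, Multiset.count_cons, Multiset.count_singleton]
  grind

lemma sum_range_mul_count {n : ℕ} (p : Nat.Partition n) (f : ℕ → ℝ) :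
    ∑ m ∈ Finset.range (n + 1), p.parts.count m * f m = (p.parts.map f).sum := by
  rw [Finset.sum_multiset_map_count]
  simp only [nsmul_eq_mul]
  symm
  refine Finset.sum_subset (fun a ha => ?_) fun a _ ha => ?_
  · have := Nat.Partition.le_of_mem_parts (Multiset.mem_toFinset.1 ha)
    simp only [Finset.mem_range]
    omega
  · rw [Multiset.mem_toFinset] at ha
    simp [Multiset.count_eq_zero.2 ha]

lemma sum_Kmat_mul_oneSubPowProd {n : ℕ} (l : PartN n) {x : ℝ} (hx : x ∈ Ioo (0 : ℝ) 1) :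
    ∑ l' : PartN n, Kmat n l l' * oneSubPowProd x (PartN.toPartition l').parts =
      oneSubPowProd x (PartN.toPartition l).parts / (n * (n - 1)) *
        (2 * n * ((PartN.toPartition l).parts.map fun m : ℕ => (m : ℝ) / (1 - x ^ m)).sum
          - n ^ 2 + n - 2 * n / (1 - x)) := by
  classical
  set p := PartN.toPartition l with hp
  have hcount : ∀ m, typeCount l m = p.parts.count m := typeCount_eq_count l
  have hN' : ∀ m, n < m → p.parts.count m = 0 := fun m hm =>
    Multiset.count_eq_zero.2 fun h => (Nat.Partition.le_of_mem_parts h).not_gt hm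
  have hN : ∑ m ∈ Finset.range (n + 1), m * p.parts.count m = n := by
    have h := sum_range_mul_count p (fun m => (m : ℝ))
    have h2 : (p.parts.map fun m : ℕ => (m : ℝ)).sum = n := by
      conv_rhs => rw [← p.parts_sum]
      simp
    rw [h2] at h
    simp only [mul_comm ((p.parts.count _ : ℕ) : ℝ)] at h
    exact_mod_cast h
  have key := sum_merge_split (fun m => p.parts.count m) hN hN' hx
  have e : ∑ m ∈ Finset.range (n + 1), (m : ℝ) * p.parts.count m / (1 - x ^ m) =
      (p.parts.map fun m : ℕ => (m : ℝ) / (1 - x ^ m)).sum := by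
    rw [← sum_range_mul_count]
    exact Finset.sum_congr rfl fun m _ => by ring
  rw [e] at key
  rw [← key]
  simp only [Kmat, Finset.sum_mul, add_mul, Finset.sum_add_distrib, mul_add, Finset.mul_sum]
  have pair (a b : ℕ) : oneSubPowProd x {a, b} = (1 - x ^ a) * (1 - x ^ b) := by
    simp [oneSubPowProd]
  have single (a : ℕ) : oneSubPowProd x {a} = 1 - x ^ a := by simp [oneSubPowProd]
  refine congrArg₂ (· + ·) (congrArg₂ (· + ·) ?_ ?_) (congrArg₂ (· + ·) ?_ ?_)
  · rw [Finset.sum_comm]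
    refine Finset.sum_congr rfl fun j _ => ?_
    rw [Finset.sum_comm]
    refine Finset.sum_congr rfl fun k _ => ?_
    by_cases h : 1 ≤ j ∧ j < k
    · simp only [h.1, h.2, true_and, and_self, if_true, hcount]
      rw [sum_ite_exchange p (A := {j, k}) (B := {j + k}) (by simp) (by simp; omega)
        (by simp; omega) hx ?_ (fun l' => MergeRel j k l l') fun l' => mergeRel_iff l l' h.1 h.2,
        pair, single]
      · ring
      · intro h0
        refine pair_le_of_count h.2.ne ?_ ?_ <;> intro h1 <;> simp [h1] at h0
    · simp only [← and_assoc, h, false_and, if_false]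
      simp
  · rw [Finset.sum_comm]
    refine Finset.sum_congr rfl fun j _ => ?_
    rw [Finset.sum_comm]
    refine Finset.sum_congr rfl fun k _ => ?_
    by_cases h : 1 ≤ j ∧ j < k
    · simp only [h.1, h.2, true_and, and_self, if_true, hcount]
      rw [sum_ite_exchange p (A := {j + k}) (B := {j, k}) (by simp) (by simp; omega)
        (by simp; omega) hx ?_ (fun l' => MergeRel j k l' l)
        fun l' => (mergeRel_iff l' l h.1 h.2).trans eq_comm, pair, single]
      · ring
      · intro h0
        refine Multiset.singleton_le.2 (Multiset.count_ne_zero.1 fun h1 => ?_)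
        simp [h1] at h0
    · simp only [← and_assoc, h, false_and, if_false]
      simp
  · rw [Finset.sum_comm]
    refine Finset.sum_congr rfl fun j _ => ?_
    by_cases h : 1 ≤ j ∧ 2 * j ≤ n
    · simp only [h.1, h.2, true_and, and_self, if_true, hcount]
      rw [sum_ite_exchange p (A := {j, j}) (B := {j + j}) (by simp) (by simp; omega)
        (by simp; omega) hx ?_ (fun l' => EqMergeRel j l l') fun l' => eqMergeRel_iff l l' h.1,
        pair, single]
      · ring
      · intro h0
        have h2 : Multiset.replicate 2 j ≤ p.parts := by
          rw [← Multiset.le_count_iff_replicate_le]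
          by_contra! h3
          interval_cases p.parts.count j <;> simp at h0
        exact h2
    · simp only [← and_assoc, h, false_and, if_false]
      simp
  · rw [Finset.sum_comm]
    refine Finset.sum_congr rfl fun j _ => ?_
    by_cases h : 1 ≤ j ∧ 2 * j ≤ n
    · simp only [h.1, h.2, true_and, and_self, if_true, hcount]
      rw [sum_ite_exchange p (A := {j + j}) (B := {j, j}) (by simp) (by simp; omega)
        (by simp; omega) hx ?_ (fun l' => EqMergeRel j l' l)
        fun l' => (eqMergeRel_iff l' l h.1).trans eq_comm, pair, single]
      · rw [two_mul j]; ring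
      · intro h0
        refine Multiset.singleton_le.2 (Multiset.count_ne_zero.1 fun h1 => ?_)
        simp [two_mul j, h1] at h0
    · simp only [← and_assoc, h, false_and, if_false]
      simp

/-! ### The generator as a differential operator on polynomials -/

section Polynomials

open Polynomial

/-- The polynomial `∏ (1 - X ^ a)` over the elements `a` of a multiset. -/
def oneSubPowPoly (s : Multiset ℕ) : ℝ[X] := (s.map fun a => 1 - X ^ a).prod

lemma eval_oneSubPowPoly (x : ℝ) (s : Multiset ℕ) :
    (oneSubPowPoly s).eval x = oneSubPowProd x s := by
  simp [oneSubPowPoly, oneSubPowProd, eval_multiset_prod, Multiset.map_map]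

lemma oneSubPowPoly_cons (a : ℕ) (s : Multiset ℕ) :
    oneSubPowPoly (a ::ₘ s) = (1 - X ^ a) * oneSubPowPoly s := by
  simp [oneSubPowPoly]

lemma mul_eval_derivative_oneSubPowPoly {x : ℝ} (hx : x ∈ Ioo (0 : ℝ) 1) (s : Multiset ℕ)
    (hs : ∀ a ∈ s, a ≠ 0) :
    x * (derivative (oneSubPowPoly s)).eval x =
      oneSubPowProd x s * (s.sum - (s.map fun m : ℕ => (m : ℝ) / (1 - x ^ m)).sum) := by
  induction s using Multiset.induction with
  | empty => simp [oneSubPowPoly]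
  | cons a s ih =>
    have ha : a ≠ 0 := hs a (Multiset.mem_cons_self a s)
    have ih := ih fun b hb => hs b (Multiset.mem_cons_of_mem hb)
    have h0 := one_sub_pow_ne_zero hx ha
    have hpow : x * x ^ (a - 1) = x ^ a := mul_pow_sub_one ha x
    have hcons : oneSubPowProd x (a ::ₘ s) = (1 - x ^ a) * oneSubPowProd x s := by
      simp [oneSubPowProd]
    rw [oneSubPowPoly_cons, hcons]
    simp only [derivative_mul, derivative_sub, derivative_one, derivative_X_pow, eval_add,
      eval_mul, eval_sub, eval_zero, eval_one, eval_pow, eval_X, eval_C, eval_oneSubPowPoly,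
      Multiset.sum_cons, Multiset.map_cons, Nat.cast_add]
    have : x * ((0 - a * x ^ (a - 1)) * oneSubPowProd x s +
        (1 - x ^ a) * (derivative (oneSubPowPoly s)).eval x) =
        -a * (x * x ^ (a - 1)) * oneSubPowProd x s +
          (1 - x ^ a) * (x * (derivative (oneSubPowPoly s)).eval x) := by ring
    rw [this, ih, hpow]
    field_simp
    ring

lemma sum_Kmat_mul_oneSubPowPoly {n : ℕ} (hn : 2 ≤ n) (l : PartN n) :
    (1 - X) * ∑ l' : PartN n, C (Kmat n l l') * oneSubPowPoly (PartN.toPartition l').parts =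
      (1 - X) * oneSubPowPoly (PartN.toPartition l).parts -
        C (2 / ((n : ℝ) - 1)) * X *
          ((1 - X) * derivative (oneSubPowPoly (PartN.toPartition l).parts) +
            oneSubPowPoly (PartN.toPartition l).parts) := by
  refine Polynomial.eq_of_infinite_eval_eq _ _
    ((Ioo_infinite (zero_lt_one (α := ℝ))).mono fun x hx => ?_)
  have h1 : 1 - x ≠ 0 := (sub_pos.2 hx.2).ne'
  have hn0 : (n : ℝ) ≠ 0 := by positivity
  have hn1 : (n : ℝ) - 1 ≠ 0 := by
    have : (2 : ℝ) ≤ n := by exact_mod_cast hn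
    linarith
  have hd := mul_eval_derivative_oneSubPowPoly hx (PartN.toPartition l).parts
    fun a ha => ((PartN.toPartition l).parts_pos ha).ne'
  rw [(PartN.toPartition l).parts_sum] at hd
  simp only [Set.mem_ofPred_eq, eval_mul, eval_sub, eval_one, eval_X, eval_finsetSum, eval_C,
    eval_add, eval_oneSubPowPoly, sum_Kmat_mul_oneSubPowProd l hx]
  rw [mul_assoc (2 / ((n : ℝ) - 1)), mul_add, mul_left_comm x, hd]
  field_simp
  ring

lemma sum_Kpow_mul_oneSubPowPoly {n : ℕ} (hn : 2 ≤ n) (k : ℕ) :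
    ∑ l : PartN n, C (Kpow n k (oneBlock n) l) * oneSubPowPoly (PartN.toPartition l).parts =
      (1 - X) * ∑ r ∈ Finset.range n, C ((1 - 2 * (r : ℝ) / (n - 1)) ^ k) * X ^ r := by
  have hX : (1 - X : ℝ[X]) ≠ 0 := fun h => by
    have := congrArg (eval 0) h
    simp at this
  induction k with
  | zero =>
    have hs := oneBlock_mem n
    rw [Finset.sum_eq_single ⟨oneBlock n, hs⟩]
    · simp [Kpow, toPartition_oneBlock (n := n) (by omega), oneSubPowPoly, mul_neg_geom_sum]
    · intro l _ hl
      have : oneBlock n ≠ l := fun h => hl (Subtype.ext h.symm)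
      simp [Kpow, this]
    · simp
  | succ k ih =>
    set v : ℝ[X] := ∑ r ∈ Finset.range n, C ((1 - 2 * (r : ℝ) / (n - 1)) ^ k) * X ^ r with hv
    set g : ℝ[X] := ∑ l : PartN n, C (Kpow n k (oneBlock n) l) *
      oneSubPowPoly (PartN.toPartition l).parts with hg
    have hg' : derivative g = ∑ l : PartN n, C (Kpow n k (oneBlock n) l) *
        derivative (oneSubPowPoly (PartN.toPartition l).parts) := by
      simp [hg]
    have hv' : ∑ r ∈ Finset.range n, C ((1 - 2 * (r : ℝ) / (n - 1)) ^ (k + 1)) * X ^ r =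
        v - C (2 / ((n : ℝ) - 1)) * X * derivative v := by
      simp only [hv, derivative_sum, Finset.mul_sum, ← Finset.sum_sub_distrib]
      refine Finset.sum_congr rfl fun r _ => ?_
      have h1 : C (r : ℝ) * (X * X ^ (r - 1)) = (C (r : ℝ) * X ^ r : ℝ[X]) := by
        rcases eq_or_ne r 0 with rfl | hr
        · simp
        · rw [mul_pow_sub_one hr]
      have h2 : (1 - 2 * (r : ℝ) / (n - 1)) = 1 - 2 / (n - 1) * r := by ring
      rw [derivative_C_mul_X_pow, pow_succ, h2]
      simp only [C_mul, C_sub, C_1]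
      linear_combination (C (2 / ((n : ℝ) - 1)) * C ((1 - 2 / (n - 1) * (r : ℝ)) ^ k)) * h1
    have hstep : (1 - X) * ∑ l : PartN n, C (Kpow n (k + 1) (oneBlock n) l) *
        oneSubPowPoly (PartN.toPartition l).parts =
        (1 - X) * g - C (2 / ((n : ℝ) - 1)) * X * ((1 - X) * derivative g + g) := by
      have h1 : ∑ l : PartN n, C (Kpow n (k + 1) (oneBlock n) l) *
          oneSubPowPoly (PartN.toPartition l).parts =
          ∑ x : PartN n, C (Kpow n k (oneBlock n) x) *
            ∑ l : PartN n, C (Kmat n x l) * oneSubPowPoly (PartN.toPartition l).parts := by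
        simp only [Kpow, tsum_fintype, map_sum, C_mul, Finset.sum_mul, Finset.mul_sum]
        rw [Finset.sum_comm]
        simp only [mul_assoc]
      rw [h1, Finset.mul_sum, hg', hg]
      simp only [Finset.mul_sum, ← Finset.sum_add_distrib, ← Finset.sum_sub_distrib]
      refine Finset.sum_congr rfl fun x _ => ?_
      rw [← Finset.mul_sum, ← Finset.mul_sum, mul_left_comm, sum_Kmat_mul_oneSubPowPoly hn x]
      ring
    refine mul_left_cancel₀ hX ?_
    rw [hstep, hv', ih, derivative_mul]
    simp only [derivative_sub, derivative_one, derivative_X]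
    ring

open Classical in
lemma eval_one_derivative_oneSubPowPoly {n : ℕ} (hn : n ≠ 0) (l : PartN n) :
    (derivative (oneSubPowPoly (PartN.toPartition l).parts)).eval 1 =
      if l = ⟨oneBlock n, oneBlock_mem n⟩ then -(n : ℝ) else 0 := by
  split_ifs with h
  · rw [h, toPartition_oneBlock hn]
    simp [oneSubPowPoly, derivative_X_pow]
  · have hsum := (PartN.toPartition l).parts_sum
    obtain ⟨a, t, ht⟩ : ∃ a t, (PartN.toPartition l).parts = a ::ₘ t := by
      have hne : (PartN.toPartition l).parts ≠ 0 := fun h0 => by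
        rw [h0, Multiset.sum_zero] at hsum
        exact hn hsum.symm
      obtain ⟨a, ha⟩ := Multiset.exists_mem_of_ne_zero hne
      exact ⟨a, Multiset.exists_cons_of_mem ha⟩
    rcases t.empty_or_exists_mem with rfl | ⟨b, hb⟩
    · refine absurd (PartN.toPartition_injective n (Nat.Partition.ext ?_)) h
      rw [toPartition_oneBlock hn, ht]
      rw [ht] at hsum
      simpa using hsum
    · obtain ⟨u, rfl⟩ := Multiset.exists_cons_of_mem hb
      rw [ht, oneSubPowPoly_cons, oneSubPowPoly_cons]
      simp

lemma Kpow_oneBlock {n : ℕ} (hn : 2 ≤ n) (k : ℕ) :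
    Kpow n k (oneBlock n) (oneBlock n) =
      1 / (n : ℝ) * ∑ r ∈ Finset.range n, (1 - 2 * (r : ℝ) / (n - 1)) ^ k := by
  have h0 : n ≠ 0 := by omega
  have hn0 : (n : ℝ) ≠ 0 := by positivity
  have h := congrArg (fun p => (derivative p).eval 1) (sum_Kpow_mul_oneSubPowPoly hn k)
  simp only [derivative_sum, derivative_C_mul, eval_finsetSum, eval_mul, eval_C,
    eval_one_derivative_oneSubPowPoly h0, mul_ite, mul_zero, Finset.sum_ite_eq', Finset.mem_univ,
    if_true] at h
  simp only [derivative_mul, derivative_sub, derivative_one, derivative_X, eval_add, eval_mul,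
    eval_sub, eval_one, eval_X, eval_zero, sub_self, zero_mul, add_zero, eval_finsetSum, eval_C,
    eval_pow, one_pow, mul_one] at h
  rw [one_div, eq_inv_mul_iff_mul_eq₀ hn0]
  linarith

end Polynomials

lemma le_sum_pow {n k : ℕ} (hn : 2 ≤ n) (hk : 1 ≤ k) :
    ((n : ℝ) - 1) / (16 * k) ≤
      ∑ r ∈ Finset.range n, (1 - 2 * (r : ℝ) / (n - 1)) ^ (2 * k) := by
  have hn2 : (2 : ℝ) ≤ n := by exact_mod_cast hn
  have hn1 : (0 : ℝ) < (n : ℝ) - 1 := by linarith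
  have hk1 : (1 : ℝ) ≤ k := by exact_mod_cast hk
  have hk0 : (0 : ℝ) < k := by linarith
  set m := ⌊((n : ℝ) - 1) / (8 * k)⌋₊ with hm
  have hm1 : (m : ℝ) ≤ ((n : ℝ) - 1) / (8 * k) := Nat.floor_le (by positivity)
  have hm2 : ((n : ℝ) - 1) / (8 * k) < m + 1 := Nat.lt_floor_add_one _
  rw [le_div_iff₀ (by positivity)] at hm1
  have hmn : m + 1 ≤ n := by
    have : (m : ℝ) + 1 ≤ n := by nlinarith [(Nat.cast_nonneg m : (0 : ℝ) ≤ m)]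
    exact_mod_cast this
  calc ((n : ℝ) - 1) / (16 * k) = ((n : ℝ) - 1) / (8 * k) * (1 / 2) := by field_simp; norm_num
    _ ≤ (m + 1) * (1 / 2) := by gcongr
    _ = ∑ r ∈ Finset.range (m + 1), (1 / 2 : ℝ) := by simp
    _ ≤ ∑ r ∈ Finset.range (m + 1), (1 - 2 * (r : ℝ) / (n - 1)) ^ (2 * k) := by
        refine Finset.sum_le_sum fun r hr => ?_
        have hr : (r : ℝ) ≤ m := by
          simp only [Finset.mem_range] at hr
          exact_mod_cast (by omega : r ≤ m)
        have h1 : (r : ℝ) * (8 * k) ≤ n - 1 := le_trans (by gcongr) hm1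
        have h2 : (k : ℝ) * (2 * r / (n - 1)) ≤ 1 / 4 := by
          rw [← mul_div_assoc, div_le_iff₀ hn1]
          linarith
        have h3 : 0 ≤ 2 * (r : ℝ) / (n - 1) := by positivity
        have h4 : 2 * (r : ℝ) / (n - 1) ≤ 1 / 4 := by nlinarith
        have := one_add_mul_le_pow (a := -(2 * (r : ℝ) / (n - 1))) (by linarith) (2 * k)
        rw [← sub_eq_add_neg] at this
        push_cast at this
        linarith
    _ ≤ _ := by
        refine Finset.sum_le_sum_of_subset_of_nonneg (Finset.range_subset_range.2 hmn) ?_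
        intro r _ _
        rw [pow_mul]
        positivity

/-- **Return probability of DCF⁽ⁿ⁾ from the one-part state** (note added in
proof): for `n ≥ 2` and `k ≥ 1`,
`P(X⁽ⁿ⁾(2k) = sₙ) = (1/n) Σ_{i=1}^n ((2i−n−1)/(n−1))^{2k}`, and there is a
constant `C > 0`, independent of `n` and `k`, with
`P(X⁽ⁿ⁾(2k) = sₙ) ≥ C/k` for all `1 ≤ k < n`. -/
theorem dcf_return_probability :
    (∀ n : ℕ, 2 ≤ n → ∀ k : ℕ, 1 ≤ k →
      Kpow n (2 * k) (oneBlock n) (oneBlock n) =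
        (1 / (n : ℝ)) * ∑ i ∈ Finset.Icc 1 n,
          ((2 * (i : ℝ) - (n : ℝ) - 1) / ((n : ℝ) - 1)) ^ (2 * k)) ∧
    (∃ C : ℝ, 0 < C ∧ ∀ n : ℕ, 2 ≤ n → ∀ k : ℕ, 1 ≤ k → k < n →
      C / (k : ℝ) ≤ Kpow n (2 * k) (oneBlock n) (oneBlock n)) := by
  constructor
  · intro n hn k _
    have hn1 : (n : ℝ) - 1 ≠ 0 := by
      have : (2 : ℝ) ≤ n := by exact_mod_cast hn
      linarith
    rw [Kpow_oneBlock hn, ← Finset.Ico_add_one_right_eq_Icc, Finset.sum_Ico_eq_sum_range,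
      Nat.add_sub_cancel]
    congr 1
    refine Finset.sum_congr rfl fun r _ => ?_
    rw [← (even_two_mul k).neg_pow]
    congr 1
    push_cast
    field_simp
    ring
  · refine ⟨1 / 32, by norm_num, fun n hn k hk _ => ?_⟩
    have hn2 : (2 : ℝ) ≤ n := by exact_mod_cast hn
    have hk0 : (0 : ℝ) < k := by exact_mod_cast hk
    rw [Kpow_oneBlock hn]
    calc 1 / 32 / (k : ℝ) ≤ 1 / (n : ℝ) * (((n : ℝ) - 1) / (16 * k)) := by
          rw [div_div, div_mul_div_comm, div_le_div_iff₀ (by positivity) (by positivity)]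
          nlinarith
      _ ≤ _ := by
          gcongr
          exact le_sum_pow hn hk

end
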